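/- With u_θ = φ₁ cos θ - φ₂ sin θ on Ω = (0,1)² and g(θ) = -∫_Ω u_θ² log|u_θ|, suppose g is twice differentiable; then g''(θ) = -2( 1/4 + g(θ) + ∫_Ω (u'_θ)² log|u_θ| dx dy ), where u'_θ = ∂u_θ/∂θ. In particular, g''(θ) > 0 if and only if -∫_Ω (u'_θ)² log|u_θ| > 1/4 + g(θ). -/

import Mathlib

open Real MeasureTheory Set

/-- singular weight -/
noncomputable def sw (s : ℝ) : ENNReal := if s = 0 then ⊤ else ENNReal.ofReal (1 / √|s|)

lemma sw_meas : Measurable sw := by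
  unfold sw
  refine Measurable.ite (measurableSet_singleton 0) measurable_const ?_
  fun_prop

lemma sw_int : ∫⁻ s in Icc (-2:ℝ) 2, sw s < ⊤ := by
  have h1 : ∫⁻ s in Icc (-2:ℝ) 2, sw s = ∫⁻ s in Icc (-2:ℝ) 2, ENNReal.ofReal (|s|^(-(1/2):ℝ)) := by
    refine lintegral_congr_ae (ae_restrict_of_ae ?_)
    filter_upwards [compl_mem_ae_iff.mpr (measure_singleton (0:ℝ))] with s hs
    have hs : s ≠ 0 := hs
    simp only [sw, hs, if_false]
    rw [Real.rpow_neg (abs_nonneg _), Real.sqrt_eq_rpow, one_div]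
  rw [h1]
  have hp : IntegrableOn (fun s : ℝ => |s|^(-(1/2):ℝ)) (Ioc 0 2) := by
    have := (intervalIntegral.intervalIntegrable_rpow' (a := 0) (b := 2) (r := -(1/2)) (by norm_num))
    rw [intervalIntegrable_iff_integrableOn_Ioc_of_le (by norm_num)] at this
    refine this.congr_fun (fun s hs => ?_) measurableSet_Ioc
    simp only [abs_of_pos hs.1]
  have hn : IntegrableOn (fun s : ℝ => |s|^(-(1/2):ℝ)) (Ico (-2) 0) := by
    have := hp.comp_neg
    simpa using this
  have hI : IntegrableOn (fun s : ℝ => |s|^(-(1/2):ℝ)) (Icc (-2) 2) := by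
    have h0 : IntegrableOn (fun s : ℝ => |s|^(-(1/2):ℝ)) {0} := by
      simp [integrableOn_singleton_iff]
    refine ((hp.union hn).union h0).mono_set ?_
    intro s hs
    rcases lt_trichotomy s 0 with h | h | h
    · left; right; exact ⟨hs.1, h⟩
    · right; exact h
    · left; left; exact ⟨h, hs.2⟩
  exact hI.lintegral_lt_top

lemma one_dim (β c : ℝ) (h1 : 1/2 ≤ |β|) (h2 : |β| ≤ 1) (h3 : |c| ≤ 1) :
    ∫⁻ y in Ioo (0:ℝ) 1, ENNReal.ofReal (sin (π * y)) * sw (β * cos (π * y) - c)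
      ≤ ∫⁻ s in Icc (-2:ℝ) 2, sw s := by
  have hb : β ≠ 0 := by
    rintro rfl; simp at h1; linarith
  have hd : ∀ y ∈ Ioo (0:ℝ) 1, HasDerivWithinAt (fun y => β * cos (π * y) - c)
      (β * (-sin (π * y) * π)) (Ioo 0 1) y := by
    intro y _
    have := ((((hasDerivAt_id y).const_mul π).cos).const_mul β).sub_const c
    refine (this.congr_deriv ?_).hasDerivWithinAt
    simp
  have hinj : InjOn (fun y => β * cos (π * y) - c) (Ioo 0 1) := by
    intro a ha b hb' hab
    have h4 : cos (π * a) = cos (π * b) := by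
      have : β * cos (π * a) = β * cos (π * b) := by simpa using hab
      exact mul_left_cancel₀ hb this
    have hpi := Real.pi_pos
    have := Real.injOn_cos (x₁ := π * a) (x₂ := π * b)
      ⟨by nlinarith [ha.1], by nlinarith [ha.2]⟩ ⟨by nlinarith [hb'.1], by nlinarith [hb'.2]⟩ h4
    exact mul_left_cancel₀ hpi.ne' this
  calc _ ≤ ∫⁻ y in Ioo (0:ℝ) 1, ENNReal.ofReal |β * (-sin (π * y) * π)| * sw (β * cos (π * y) - c) := by
        refine setLIntegral_mono' measurableSet_Ioo fun y hy => ?_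
        gcongr
        have hs : 0 ≤ sin (π * y) := sin_nonneg_of_nonneg_of_le_pi
          (by nlinarith [hy.1, pi_pos]) (by nlinarith [hy.2, pi_pos])
        rw [abs_mul, abs_mul, abs_neg, abs_of_nonneg hs, abs_of_pos pi_pos]
        have : 1 ≤ |β| * π := by nlinarith [pi_gt_three]
        nlinarith
    _ = ∫⁻ s in (fun y => β * cos (π * y) - c) '' Ioo 0 1, sw s :=
        (lintegral_image_eq_lintegral_abs_deriv_mul measurableSet_Ioo hd hinj sw).symm
    _ ≤ _ := by
        refine lintegral_mono_set ?_
        rintro _ ⟨y, hy, rfl⟩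
        have : |β * cos (π * y)| ≤ 1 := by
          rw [abs_mul]; exact mul_le_one₀ h2 (abs_nonneg _) (abs_cos_le_one _)
        have h5 := abs_le.1 this
        have h6 := abs_le.1 h3
        constructor <;> simp only <;> linarith

lemma two_dim (θ : ℝ) :
    ∫⁻ p in (Ioo (0:ℝ) 1) ×ˢ (Ioo (0:ℝ) 1), ENNReal.ofReal (sin (π * p.1) * sin (π * p.2)) *
      sw (cos θ * cos (π * p.2) - sin θ * cos (π * p.1)) ≤ ∫⁻ s in Icc (-2:ℝ) 2, sw s := by
  have hm : Measurable (fun p : ℝ × ℝ => ENNReal.ofReal (sin (π * p.1) * sin (π * p.2)) *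
      sw (cos θ * cos (π * p.2) - sin θ * cos (π * p.1))) := by
    refine Measurable.mul (by fun_prop) (sw_meas.comp (by fun_prop))
  have hs : ∀ y ∈ Ioo (0:ℝ) 1, 0 ≤ sin (π * y) := fun y hy => sin_nonneg_of_nonneg_of_le_pi
          (by nlinarith [hy.1, pi_pos]) (by nlinarith [hy.2, pi_pos])
  have hcs := sin_sq_add_cos_sq θ
  have hv : (volume : Measure ℝ) (Ioo 0 1) = 1 := by simp
  have hpr : (volume : Measure (ℝ × ℝ)).restrict ((Ioo (0:ℝ) 1) ×ˢ (Ioo (0:ℝ) 1)) =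
      (volume.restrict (Ioo (0:ℝ) 1)).prod (volume.restrict (Ioo (0:ℝ) 1)) := by
    rw [Measure.prod_restrict]; rfl
  rw [hpr]
  by_cases h : 1/2 ≤ |cos θ|
  · rw [lintegral_prod _ hm.aemeasurable]
    calc _ ≤ ∫⁻ x in Ioo (0:ℝ) 1, ∫⁻ s in Icc (-2:ℝ) 2, sw s := by
          refine setLIntegral_mono' measurableSet_Ioo fun x hx => ?_
          refine le_trans (setLIntegral_mono' measurableSet_Ioo fun y hy => ?_)
            (one_dim (cos θ) (sin θ * cos (π * x)) h (abs_cos_le_one _) ?_)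
          · dsimp only
            gcongr
            nlinarith [hs x hx, hs y hy, sin_le_one (π * x)]
          · rw [abs_mul]; exact mul_le_one₀ (abs_sin_le_one _) (abs_nonneg _) (abs_cos_le_one _)
      _ = _ := by rw [setLIntegral_const, hv, mul_one]
  · have h' : 1/2 ≤ |sin θ| := by
      push Not at h
      by_contra! h2
      nlinarith [sq_abs (sin θ), sq_abs (cos θ), abs_nonneg (sin θ), abs_nonneg (cos θ)]
    rw [lintegral_prod_symm _ hm.aemeasurable]
    calc _ ≤ ∫⁻ x in Ioo (0:ℝ) 1, ∫⁻ s in Icc (-2:ℝ) 2, sw s := by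
          refine setLIntegral_mono' measurableSet_Ioo fun y hy => ?_
          refine le_trans (setLIntegral_mono' measurableSet_Ioo fun x hx => ?_)
            (one_dim (-sin θ) (-cos θ * cos (π * y)) (by rwa [abs_neg])
              (by rw [abs_neg]; exact abs_sin_le_one _) ?_)
          · dsimp only
            have e : cos θ * cos (π * y) - sin θ * cos (π * x) = -sin θ * cos (π * x) - -cos θ * cos (π * y) := by ring
            rw [e]
            gcongr
            nlinarith [hs x hx, hs y hy, sin_le_one (π * y)]
          · rw [abs_mul, abs_neg]; exact mul_le_one₀ (abs_cos_le_one _) (abs_nonneg _) (abs_cos_le_one _)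
      _ = _ := by rw [setLIntegral_const, hv, mul_one]

noncomputable def f1 (p : ℝ × ℝ) : ℝ := Real.sin (π * p.1) * Real.sin (2 * π * p.2)
noncomputable def f2 (p : ℝ × ℝ) : ℝ := Real.sin (2 * π * p.1) * Real.sin (π * p.2)
noncomputable def uu (θ : ℝ) (p : ℝ × ℝ) : ℝ := f1 p * cos θ - f2 p * sin θ
noncomputable def vv (θ : ℝ) (p : ℝ × ℝ) : ℝ := -f1 p * sin θ - f2 p * cos θ
noncomputable def RR (p : ℝ × ℝ) : ℝ := f1 p ^ 2 + f2 p ^ 2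
/-- the square with Lebesgue measure -/
noncomputable def mu : Measure (ℝ × ℝ) := volume.restrict ((Ioo (0:ℝ) 1) ×ˢ (Ioo (0:ℝ) 1))

@[fun_prop] lemma f1_cont : Continuous f1 := by unfold f1; fun_prop
@[fun_prop] lemma f2_cont : Continuous f2 := by unfold f2; fun_prop
@[fun_prop] lemma uu_cont : Continuous (fun q : ℝ × (ℝ × ℝ) => uu q.1 q.2) := by unfold uu; fun_prop
@[fun_prop] lemma vv_cont : Continuous (fun q : ℝ × (ℝ × ℝ) => vv q.1 q.2) := by unfold vv; fun_prop
@[fun_prop] lemma uu_cont' (θ : ℝ) : Continuous (uu θ) := by unfold uu; fun_prop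
@[fun_prop] lemma vv_cont' (θ : ℝ) : Continuous (vv θ) := by unfold vv; fun_prop
@[fun_prop] lemma RR_cont : Continuous RR := by unfold RR; fun_prop

lemma RR_eq (θ : ℝ) (p : ℝ × ℝ) : uu θ p ^ 2 + vv θ p ^ 2 = RR p := by
  unfold uu vv RR
  linear_combination (f1 p ^ 2 + f2 p ^ 2) * sin_sq_add_cos_sq θ

lemma RR_nonneg (p) : 0 ≤ RR p := by unfold RR; positivity

lemma uu_deriv (θ p) : HasDerivAt (fun t => uu t p) (vv θ p) θ := by
  unfold uu vv
  have := ((hasDerivAt_cos θ).const_mul (f1 p)).sub ((hasDerivAt_sin θ).const_mul (f2 p))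
  refine this.congr_deriv (by ring)

lemma vv_deriv (θ p) : HasDerivAt (fun t => vv t p) (-uu θ p) θ := by
  unfold uu vv
  have := ((hasDerivAt_sin θ).const_mul (-f1 p)).sub ((hasDerivAt_cos θ).const_mul (f2 p))
  refine this.congr_deriv (by ring)

lemma int_of_cont {h : ℝ × ℝ → ℝ} (hc : Continuous h) : Integrable h mu := by
  have : IntegrableOn h (Icc (0:ℝ) 1 ×ˢ Icc (0:ℝ) 1) :=
    hc.continuousOn.integrableOn_compact (isCompact_Icc.prod isCompact_Icc)
  exact this.mono_set (prod_mono Ioo_subset_Icc_self Ioo_subset_Icc_self)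

lemma mu_ae : ∀ᵐ p ∂mu, p ∈ (Ioo (0:ℝ) 1) ×ˢ (Ioo (0:ℝ) 1) :=
  ae_restrict_mem (measurableSet_Ioo.prod measurableSet_Ioo)

instance mu_finite : IsFiniteMeasure mu := by
  refine ⟨?_⟩
  unfold mu
  rw [Measure.restrict_apply_univ, Measure.volume_eq_prod, Measure.prod_prod]
  simp

lemma hasDeriv_int (F F' : ℝ → ℝ × ℝ → ℝ) (hF : Continuous (fun q : ℝ × (ℝ × ℝ) => F q.1 q.2))
    (hF' : Continuous (fun q : ℝ × (ℝ × ℝ) => F' q.1 q.2))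
    (hd : ∀ θ p, HasDerivAt (fun t => F t p) (F' θ p) θ) (θ : ℝ) :
    HasDerivAt (fun t => ∫ p, F t p ∂mu) (∫ p, F' θ p ∂mu) θ := by
  have hFc : ∀ t, Continuous (F t) := fun t => hF.comp (by fun_prop : Continuous fun p : ℝ × ℝ => (t, p))
  have hFc' : ∀ t, Continuous (F' t) := fun t => hF'.comp (by fun_prop : Continuous fun p : ℝ × ℝ => (t, p))
  obtain ⟨C, hC⟩ := ((isCompact_Icc (a := θ - 1) (b := θ + 1)).prod
    ((isCompact_Icc (a := (0:ℝ)) (b := 1)).prod (isCompact_Icc (a := (0:ℝ)) (b := 1)))).exists_bound_of_continuousOn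
    hF'.continuousOn
  refine (hasDerivAt_integral_of_dominated_loc_of_deriv_le (bound := fun _ => C)
    (s := Icc (θ - 1) (θ + 1)) (Icc_mem_nhds (by linarith) (by linarith))
    (Filter.Eventually.of_forall fun t => (hFc t).aestronglyMeasurable) (int_of_cont (hFc θ))
    (hFc' θ).aestronglyMeasurable ?_ (integrable_const C) ?_).2
  · filter_upwards [mu_ae] with p hp t ht
    exact hC (t, p) ⟨ht, Ioo_subset_Icc_self hp.1, Ioo_subset_Icc_self hp.2⟩
  · exact Filter.Eventually.of_forall fun p t _ => hd t p

lemma key : ∃ M : ℝ, ∀ θ, (∀ᵐ p ∂mu, uu θ p ≠ 0) ∧ Integrable (fun p => RR p / √|uu θ p|) mu ∧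
    ∫ p, RR p / √|uu θ p| ∂mu ≤ M := by
  refine ⟨(8 * ∫⁻ s in Icc (-2:ℝ) 2, sw s).toReal, fun θ => ?_⟩
  have h2 := two_dim θ
  have hlt := sw_int
  set A := ∫⁻ s in Icc (-2:ℝ) 2, sw s
  have hm : Measurable (fun p : ℝ × ℝ => ENNReal.ofReal (sin (π * p.1) * sin (π * p.2)) *
      sw (cos θ * cos (π * p.2) - sin θ * cos (π * p.1))) := by
    refine Measurable.mul (by fun_prop) (sw_meas.comp (by fun_prop))
  have hpos : ∀ y ∈ Ioo (0:ℝ) 1, 0 < sin (π * y) := fun y hy => sin_pos_of_pos_of_lt_pi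
          (by nlinarith [hy.1, pi_pos]) (by nlinarith [hy.2, pi_pos])
  have hu : ∀ p : ℝ × ℝ, uu θ p = 2 * (sin (π * p.1) * sin (π * p.2)) *
      (cos θ * cos (π * p.2) - sin θ * cos (π * p.1)) := by
    intro p
    unfold uu f1 f2
    rw [mul_assoc 2 π, mul_assoc 2 π, sin_two_mul, sin_two_mul]; ring
  have hR : ∀ p : ℝ × ℝ, RR p ≤ 8 * (sin (π * p.1) * sin (π * p.2)) ^ 2 := by
    intro p
    unfold RR f1 f2
    rw [mul_assoc 2 π, mul_assoc 2 π, sin_two_mul, sin_two_mul]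
    have h3 := cos_sq_le_one (π * p.1)
    have h4 := cos_sq_le_one (π * p.2)
    nlinarith [sq_nonneg (sin (π * p.1) * sin (π * p.2))]
  have hT : ∀ᵐ p ∂mu, cos θ * cos (π * p.2) - sin θ * cos (π * p.1) ≠ 0 := by
    have := ae_lt_top (μ := mu) hm (lt_of_le_of_lt h2 hlt).ne
    filter_upwards [this, mu_ae] with p hp hp2 h0
    rw [h0] at hp
    have := mul_pos (hpos _ hp2.1) (hpos _ hp2.2)
    simp [sw, ENNReal.mul_top, this] at hp
  have hle : ∀ᵐ p ∂mu, ENNReal.ofReal (RR p / √|uu θ p|) ≤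
      8 * (ENNReal.ofReal (sin (π * p.1) * sin (π * p.2)) *
      sw (cos θ * cos (π * p.2) - sin θ * cos (π * p.1))) := by
    filter_upwards [hT, mu_ae] with p hp hp2
    have hs := mul_pos (hpos _ hp2.1) (hpos _ hp2.2)
    have hs1 : sin (π * p.1) * sin (π * p.2) ≤ 1 :=
      mul_le_one₀ (sin_le_one _) (hpos _ hp2.2).le (sin_le_one _)
    have hRp := hR p
    rw [hu]
    generalize cos θ * cos (π * p.2) - sin θ * cos (π * p.1) = T at *
    generalize sin (π * p.1) * sin (π * p.2) = s at *
    simp only [sw, hp, if_false]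
    rw [← ENNReal.ofReal_mul hs.le, ← ENNReal.ofReal_ofNat 8, ← ENNReal.ofReal_mul (by norm_num)]
    apply ENNReal.ofReal_le_ofReal
    have hTp : 0 < √|T| := Real.sqrt_pos.2 (abs_pos.2 hp)
    have : s * √|T| ≤ √|2 * s * T| := by
      rw [abs_mul, Real.sqrt_mul (abs_nonneg _), abs_of_pos (by positivity : 0 < 2 * s)]
      gcongr
      apply Real.le_sqrt_of_sq_le
      nlinarith
    rw [div_le_iff₀ (by positivity)]
    calc RR p ≤ 8 * s ^ 2 := hRp
      _ = 8 * (s * (1 / √|T|)) * (s * √|T|) := by field_simp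
      _ ≤ _ := by gcongr
  have hL : ∫⁻ p, ENNReal.ofReal (RR p / √|uu θ p|) ∂mu ≤ 8 * A := by
    refine (lintegral_mono_ae hle).trans ?_
    rw [lintegral_const_mul _ hm]
    gcongr
    exact h2
  have hAt : 8 * A < ⊤ := ENNReal.mul_lt_top (by simp) hlt
  have hmeas : AEStronglyMeasurable (fun p => RR p / √|uu θ p|) mu := by
    have h1 : Measurable (fun p => RR p) := RR_cont.measurable
    have h2 : Measurable (fun p => √|uu θ p|) := (by fun_prop : Continuous (fun p => √|uu θ p|)).measurable
    exact (h1.div h2).aestronglyMeasurable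
  have hnn : ∀ p, 0 ≤ RR p / √|uu θ p| := fun p => div_nonneg (RR_nonneg p) (Real.sqrt_nonneg _)
  refine ⟨?_, ⟨hmeas, ?_⟩, ?_⟩
  · filter_upwards [hT, mu_ae] with p hp hp2
    rw [hu]
    have hs := mul_pos (hpos _ hp2.1) (hpos _ hp2.2)
    exact mul_ne_zero (by positivity) hp
  · rw [hasFiniteIntegral_iff_ofReal (Filter.Eventually.of_forall hnn)]
    exact hL.trans_lt hAt
  · rw [integral_eq_lintegral_of_nonneg_ae (Filter.Eventually.of_forall hnn) hmeas]
    exact ENNReal.toReal_mono hAt.ne hL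

lemma log_diff {t δ : ℝ} (ht : t ≠ 0) (hδ : 0 < δ) :
    |1 / 2 * log (t ^ 2 + δ ^ 4) - log t| ≤ 2 * (δ / √|t|) ∧
    |t ^ 2 / (t ^ 2 + δ ^ 4) - 1| ≤ δ / √|t| := by
  have hTp : 0 < √|t| := Real.sqrt_pos.2 (abs_pos.2 ht)
  have ht2 : t ^ 2 = √|t| ^ 4 := by
    rw [show √|t| ^ 4 = (√|t| ^ 2) ^ 2 by ring, Real.sq_sqrt (abs_nonneg _), sq_abs]
  have hlog : log t = 1 / 2 * log (t ^ 2) := by rw [Real.log_pow]; push_cast; ring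
  rw [hlog]
  have h0 : (0:ℝ) < t ^ 2 := by positivity
  generalize √|t| = r at *
  rw [ht2]
  have hy : 0 < δ / r := by positivity
  constructor
  · rw [← mul_sub, ← Real.log_div (by positivity) (by positivity)]
    have e : (r ^ 4 + δ ^ 4) / r ^ 4 = 1 + (δ / r) ^ 4 := by field_simp
    rw [e]
    generalize δ / r = y at *
    have h1 : log (1 + y ^ 4) ≤ 4 * y := by
      calc log (1 + y ^ 4) ≤ log ((1 + y) ^ 4) := by
            apply Real.log_le_log (by positivity)
            have : 0 ≤ 4 * y + 6 * y ^ 2 + 4 * y ^ 3 := by positivity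
            nlinarith
        _ = 4 * log (1 + y) := by rw [Real.log_pow]; push_cast; ring
        _ ≤ 4 * y := by nlinarith [Real.log_le_sub_one_of_pos (by positivity : 0 < 1 + y)]
    have h2 : 0 ≤ log (1 + y ^ 4) := Real.log_nonneg (by nlinarith [pow_pos hy 4])
    rw [abs_of_nonneg (by positivity)]
    linarith
  · have e : r ^ 4 / (r ^ 4 + δ ^ 4) - 1 = - (1 - 1 / (1 + (δ / r) ^ 4)) := by field_simp; ring
    rw [e, abs_neg]
    generalize δ / r = y at *
    have h4 := pow_pos hy 4
    have h5 : 1 / (1 + y ^ 4) ≤ 1 := by rw [div_le_one (by positivity)]; linarith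
    rw [abs_of_nonneg (by linarith)]
    have h6 : 0 < 1 / (1 + y ^ 4) := by positivity
    by_cases h : y ≤ 1
    · have : 1 - 1 / (1 + y ^ 4) ≤ y ^ 4 := by
        have : 1 - y ^ 4 ≤ 1 / (1 + y ^ 4) := by
          rw [le_div_iff₀ (by positivity)]; nlinarith
        linarith
      have h7 : y ^ 4 ≤ y ^ 1 := pow_le_pow_of_le_one hy.le h (by norm_num)
      simp at h7
      linarith
    · linarith

lemma h_deriv (t : ℝ) : HasDerivAt (fun t : ℝ => t ^ 2 * log t) (2 * (t * log t) + t) t := by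
  by_cases ht : t = 0
  · subst ht
    have := (hasDerivAt_iff_tendsto_slope (f := fun t : ℝ => t ^ 2 * log t) (f' := 0) (x := 0)).2 (by
      have h1 : Filter.Tendsto (fun x : ℝ => x * log x) (nhdsWithin 0 {0}ᶜ) (nhds 0) := by
        have := (Real.continuous_mul_log.tendsto 0).mono_left (nhdsWithin_le_nhds (s := {0}ᶜ))
        simpa using this
      refine h1.congr' ?_
      filter_upwards [self_mem_nhdsWithin] with x hx
      have hx : x ≠ 0 := hx
      simp only [slope, vsub_eq_sub, sub_zero, smul_eq_mul]
      field_simp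
      simp)
    simpa using this
  · have := ((hasDerivAt_id t).pow 2).mul (Real.hasDerivAt_log ht)
    refine this.congr_deriv ?_
    simp
    field_simp

lemma int_one_a (k : ℝ) (hk : k ≠ 0) (h0 : sin k = 0) : ∫ x in Ioo (0:ℝ) 1, sin (k * x) ^ 2 = 1 / 2 := by
  rw [← integral_Ioc_eq_integral_Ioo, ← intervalIntegral.integral_of_le zero_le_one,
    intervalIntegral.integral_comp_mul_left (fun x => sin x ^ 2) hk]
  simp [integral_sin_sq, h0]
  field_simp

lemma int_one_b : ∫ x in Ioo (0:ℝ) 1, sin (π * x) * sin (2 * π * x) = 0 := by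
  rw [← integral_Ioc_eq_integral_Ioo, ← intervalIntegral.integral_of_le zero_le_one]
  have hd : ∀ x ∈ uIcc (0:ℝ) 1, HasDerivAt (fun x => 2 / (3 * π) * sin (π * x) ^ 3)
     (sin (π * x) * sin (2 * π * x)) x := by
    intro x _
    have := ((((hasDerivAt_id x).const_mul π).sin).pow 3).const_mul (2 / (3 * π))
    refine this.congr_deriv ?_
    simp only [id]
    rw [mul_assoc 2 π, sin_two_mul]
    have := pi_ne_zero
    field_simp
    push_cast
    ring
  rw [intervalIntegral.integral_eq_sub_of_hasDerivAt hd
    (Continuous.intervalIntegrable (by fun_prop) _ _)]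
  simp

lemma int11 : ∫ p, f1 p ^ 2 ∂mu = 1 / 4 := by
  have h := setIntegral_prod_mul (μ := (volume : Measure ℝ)) (ν := (volume : Measure ℝ))
    (fun x => sin (π * x) ^ 2) (fun y => sin (2 * π * y) ^ 2) (Ioo (0:ℝ) 1) (Ioo (0:ℝ) 1)
  rw [int_one_a π pi_ne_zero sin_pi, int_one_a (2 * π) (by positivity) sin_two_pi] at h
  unfold mu f1
  simp only [mul_pow]
  rw [Measure.volume_eq_prod, h]; norm_num

lemma int22 : ∫ p, f2 p ^ 2 ∂mu = 1 / 4 := by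
  have h := setIntegral_prod_mul (μ := (volume : Measure ℝ)) (ν := (volume : Measure ℝ))
    (fun x => sin (2 * π * x) ^ 2) (fun y => sin (π * y) ^ 2) (Ioo (0:ℝ) 1) (Ioo (0:ℝ) 1)
  rw [int_one_a π pi_ne_zero sin_pi, int_one_a (2 * π) (by positivity) sin_two_pi] at h
  unfold mu f2
  simp only [mul_pow]
  rw [Measure.volume_eq_prod, h]; norm_num

lemma int12 : ∫ p, f1 p * f2 p ∂mu = 0 := by
  have h := setIntegral_prod_mul (μ := (volume : Measure ℝ)) (ν := (volume : Measure ℝ))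
    (fun x => sin (π * x) * sin (2 * π * x)) (fun y => sin (π * y) * sin (2 * π * y))
      (Ioo (0:ℝ) 1) (Ioo (0:ℝ) 1)
  rw [int_one_b] at h
  unfold mu f1 f2
  rw [Measure.volume_eq_prod]
  rw [zero_mul] at h
  refine Eq.trans ?_ h
  refine integral_congr_ae (Filter.Eventually.of_forall fun p => ?_)
  simp only
  ring

lemma int_comb (a b c : ℝ) : ∫ p, (a * f1 p ^ 2 + b * (f1 p * f2 p) + c * f2 p ^ 2) ∂mu = (a + c) / 4 := by
  rw [integral_add (int_of_cont (by fun_prop)) (int_of_cont (by fun_prop)),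
    integral_add (int_of_cont (by fun_prop)) (int_of_cont (by fun_prop)),
    integral_const_mul, integral_const_mul, integral_const_mul, int11, int12, int22]
  ring

lemma int_uv (θ : ℝ) : ∫ p, uu θ p * vv θ p ∂mu = 0 := by
  have := int_comb (-(sin θ * cos θ)) (sin θ ^ 2 - cos θ ^ 2) (sin θ * cos θ)
  rw [show (0:ℝ) = (-(sin θ * cos θ) + sin θ * cos θ) / 4 by ring, ← this]
  congr 1; ext p; unfold uu vv; ring

lemma int_vv (θ : ℝ) : ∫ p, vv θ p ^ 2 ∂mu = 1 / 4 := by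
  have := int_comb (sin θ ^ 2) (2 * sin θ * cos θ) (cos θ ^ 2)
  rw [sin_sq_add_cos_sq] at this
  rw [← this]
  congr 1; ext p; unfold vv; ring

lemma G_deriv (θ : ℝ) : HasDerivAt (fun t => ∫ p, uu t p ^ 2 * log (uu t p) ∂mu)
    (2 * ∫ p, uu θ p * vv θ p * log (uu θ p) ∂mu) θ := by
  have hc : Continuous (fun q : ℝ × (ℝ × ℝ) => uu q.1 q.2 * log (uu q.1 q.2)) :=
    Real.continuous_mul_log.comp uu_cont
  have hc' : Continuous (fun p => uu θ p * log (uu θ p)) :=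
    Real.continuous_mul_log.comp (uu_cont' θ)
  have h := hasDeriv_int (fun t p => uu t p ^ 2 * log (uu t p))
    (fun t p => (2 * (uu t p * log (uu t p)) + uu t p) * vv t p)
    (by have : Continuous fun q : ℝ × (ℝ × ℝ) => uu q.1 q.2 * (uu q.1 q.2 * log (uu q.1 q.2)) := uu_cont.mul hc
        convert this using 2; ring)
    (by fun_prop) (fun t p => (h_deriv (uu t p)).comp t (uu_deriv t p)) θ
  refine h.congr_deriv ?_
  calc _ = ∫ p, (2 * ((uu θ p * log (uu θ p)) * vv θ p) + uu θ p * vv θ p) ∂mu := by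
        congr 1; ext p; ring
    _ = _ := by
        rw [integral_add (int_of_cont (by fun_prop)) (int_of_cont (by fun_prop)), int_uv, add_zero,
          integral_const_mul]
        congr 2; ext p; ring

lemma int_vlog (θ : ℝ) : Integrable (fun p => vv θ p ^ 2 * log (uu θ p)) mu := by
  obtain ⟨M, hM⟩ := key
  obtain ⟨h0, hI, -⟩ := hM θ
  have hJ : Integrable (fun p => RR p * |uu θ p|) mu := int_of_cont (by fun_prop)
  refine ((hI.const_mul 2).add hJ).mono' ?_ ?_
  · exact ((by fun_prop : Continuous fun p => vv θ p ^ 2).measurable.mul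
      (Real.measurable_log.comp (uu_cont' θ).measurable)).aestronglyMeasurable
  · filter_upwards [h0] with p hp
    have hr := RR_eq θ p
    have ha := abs_pos.2 hp
    have hs : 0 < √|uu θ p| := Real.sqrt_pos.2 ha
    have hl : |log (uu θ p)| ≤ 2 / √|uu θ p| + |uu θ p| := by
      rw [← Real.log_abs]
      have h1 := Real.log_le_sub_one_of_pos ha
      have h2 := Real.log_le_sub_one_of_pos (inv_pos.2 hs)
      rw [Real.log_inv, Real.log_sqrt ha.le] at h2
      have h3 : 2 / √|uu θ p| = 2 * (√|uu θ p|)⁻¹ := by ring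
      have h4 := inv_pos.2 hs
      rw [abs_le]
      constructor <;> nlinarith
    have : ‖vv θ p ^ 2 * log (uu θ p)‖ = vv θ p ^ 2 * |log (uu θ p)| := by
      rw [norm_mul, Real.norm_eq_abs, Real.norm_eq_abs, abs_of_nonneg (sq_nonneg _)]
    rw [this]
    calc vv θ p ^ 2 * |log (uu θ p)| ≤ RR p * (2 / √|uu θ p| + |uu θ p|) := by
          gcongr
          · exact RR_nonneg p
          · nlinarith [sq_nonneg (uu θ p)]
      _ = _ := by simp only [Pi.add_apply]; ring

lemma int_ulog (θ : ℝ) : Integrable (fun p => uu θ p ^ 2 * log (uu θ p)) mu := by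
  have hc' : Continuous (fun p => uu θ p * log (uu θ p)) :=
    Real.continuous_mul_log.comp (uu_cont' θ)
  have := int_of_cont ((uu_cont' θ).mul hc')
  refine this.congr (Filter.Eventually.of_forall fun p => ?_)
  simp only [Pi.mul_apply]; ring

set_option maxHeartbeats 1000000 in
lemma second_deriv (θ : ℝ) : HasDerivAt (fun t => ∫ p, uu t p * vv t p * log (uu t p) ∂mu)
    (∫ p, ((vv θ p ^ 2 - uu θ p ^ 2) * log (uu θ p) + vv θ p ^ 2) ∂mu) θ := by
  obtain ⟨M, hM⟩ := key
  obtain ⟨δ, hδ, hδ0⟩ : ∃ δ : ℕ → ℝ, (∀ n, 0 < δ n) ∧ Filter.Tendsto δ Filter.atTop (nhds 0) :=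
    ⟨fun n => 1 / ((n:ℝ) + 1), fun n => by positivity, tendsto_one_div_add_atTop_nhds_zero_nat⟩
  have hpos : ∀ n t p, 0 < uu t p ^ 2 + δ n ^ 4 := fun n t p => by
    have := hδ n
    positivity
  obtain ⟨F, hF⟩ : ∃ F : ℕ → ℝ → ℝ × ℝ → ℝ, F = fun n t p => uu t p * vv t p * (1 / 2 * log (uu t p ^ 2 + δ n ^ 4)) := ⟨_, rfl⟩
  obtain ⟨F', hF'⟩ : ∃ F' : ℕ → ℝ → ℝ × ℝ → ℝ, F' = fun n t p =>
    (vv t p ^ 2 - uu t p ^ 2) * (1 / 2 * log (uu t p ^ 2 + δ n ^ 4)) +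
      vv t p ^ 2 * (uu t p ^ 2 / (uu t p ^ 2 + δ n ^ 4)) := ⟨_, rfl⟩
  have hlogc : ∀ n, Continuous (fun q : ℝ × (ℝ × ℝ) => log (uu q.1 q.2 ^ 2 + δ n ^ 4)) := fun n =>
    Continuous.log (by fun_prop) (fun q => (hpos n _ _).ne')
  have hdivc : ∀ n, Continuous (fun q : ℝ × (ℝ × ℝ) => uu q.1 q.2 ^ 2 / (uu q.1 q.2 ^ 2 + δ n ^ 4)) := fun n =>
    Continuous.div (by fun_prop) (by fun_prop) (fun q => (hpos n _ _).ne')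
  have hFc : ∀ n, Continuous (fun q : ℝ × (ℝ × ℝ) => F n q.1 q.2) := fun n => by
    have := hlogc n
    simp only [hF]; fun_prop
  have hFc' : ∀ n, Continuous (fun q : ℝ × (ℝ × ℝ) => F' n q.1 q.2) := fun n => by
    have := hlogc n
    have := hdivc n
    simp only [hF']; fun_prop
  have hFi : ∀ n t, Integrable (F n t) mu := fun n t =>
    int_of_cont ((hFc n).comp (by fun_prop : Continuous fun p : ℝ × ℝ => (t, p)))
  have hFi' : ∀ n t, Integrable (F' n t) mu := fun n t =>
    int_of_cont ((hFc' n).comp (by fun_prop : Continuous fun p : ℝ × ℝ => (t, p)))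
  have hlimi : ∀ t, Integrable (fun p => (vv t p ^ 2 - uu t p ^ 2) * log (uu t p) + vv t p ^ 2) mu := fun t => by
    have := ((int_vlog t).sub (int_ulog t)).add (int_of_cont (by fun_prop : Continuous fun p => vv t p ^ 2))
    refine this.congr (Filter.Eventually.of_forall fun p => ?_)
    simp only [Pi.add_apply, Pi.sub_apply]; ring
  have hlim0 : ∀ t, Integrable (fun p => uu t p * vv t p * log (uu t p)) mu := fun t => by
    have hc' : Continuous (fun p => uu t p * log (uu t p)) :=
      Real.continuous_mul_log.comp (uu_cont' t)
    have := int_of_cont ((vv_cont' t).mul hc')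
    refine this.congr (Filter.Eventually.of_forall fun p => ?_)
    simp only [Pi.mul_apply]; ring
  have hb0 : ∀ n t, |∫ p, F n t p ∂mu - ∫ p, uu t p * vv t p * log (uu t p) ∂mu| ≤ 3 * δ n * M := by
    intro n t
    obtain ⟨h0, hI, hle⟩ := hM t
    rw [← integral_sub (hFi n t) (hlim0 t)]
    calc _ ≤ ∫ p, 3 * δ n * (RR p / √|uu t p|) ∂mu := by
          rw [← Real.norm_eq_abs]
          refine norm_integral_le_of_norm_le (hI.const_mul _) ?_
          filter_upwards [h0] with p hp
          obtain ⟨h1, -⟩ := log_diff hp (hδ n)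
          have hr := RR_eq t p
          have h3 : |uu t p * vv t p| ≤ RR p := by
            rw [abs_le]; constructor <;> nlinarith [sq_nonneg (uu t p + vv t p), sq_nonneg (uu t p - vv t p)]
          simp only [hF]
          rw [← mul_sub, norm_mul, Real.norm_eq_abs, Real.norm_eq_abs]
          calc _ ≤ RR p * (2 * (δ n / √|uu t p|)) := by
                gcongr
                exact RR_nonneg p
            _ ≤ RR p * (3 * (δ n / √|uu t p|)) := by
                have := RR_nonneg p
                have := hδ n
                gcongr
                norm_num
            _ = _ := by ring
      _ = 3 * δ n * ∫ p, (RR p / √|uu t p|) ∂mu := integral_const_mul _ _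
      _ ≤ _ := by
          have := hδ n
          gcongr
  have hb1 : ∀ n t, |∫ p, F' n t p ∂mu - ∫ p, ((vv t p ^ 2 - uu t p ^ 2) * log (uu t p) + vv t p ^ 2) ∂mu|
      ≤ 3 * δ n * M := by
    intro n t
    obtain ⟨h0, hI, hle⟩ := hM t
    rw [← integral_sub (hFi' n t) (hlimi t)]
    calc _ ≤ ∫ p, 3 * δ n * (RR p / √|uu t p|) ∂mu := by
          rw [← Real.norm_eq_abs]
          refine norm_integral_le_of_norm_le (hI.const_mul _) ?_
          filter_upwards [h0] with p hp
          obtain ⟨h1, h2⟩ := log_diff hp (hδ n)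
          have hr := RR_eq t p
          have h3 : |vv t p ^ 2 - uu t p ^ 2| ≤ RR p := by
            rw [abs_le]; constructor <;> nlinarith [sq_nonneg (uu t p), sq_nonneg (vv t p)]
          have h4 : |vv t p ^ 2| ≤ RR p := by
            rw [abs_le]; constructor <;> nlinarith [sq_nonneg (uu t p), sq_nonneg (vv t p)]
          have e : F' n t p - ((vv t p ^ 2 - uu t p ^ 2) * log (uu t p) + vv t p ^ 2) =
            (vv t p ^ 2 - uu t p ^ 2) * (1 / 2 * log (uu t p ^ 2 + δ n ^ 4) - log (uu t p)) +
            vv t p ^ 2 * (uu t p ^ 2 / (uu t p ^ 2 + δ n ^ 4) - 1) := by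
            simp only [hF']; ring
          rw [e]
          refine (norm_add_le _ _).trans ?_
          rw [norm_mul, norm_mul]
          simp only [Real.norm_eq_abs]
          calc _ ≤ RR p * (2 * (δ n / √|uu t p|)) + RR p * (δ n / √|uu t p|) := by
                have := RR_nonneg p
                gcongr
            _ = _ := by ring
      _ = 3 * δ n * ∫ p, (RR p / √|uu t p|) ∂mu := integral_const_mul _ _
      _ ≤ _ := by
          have := hδ n
          gcongr
  have hz : Filter.Tendsto (fun n => 3 * δ n * M) Filter.atTop (nhds 0) := by
    have := (hδ0.const_mul 3).mul_const M
    simpa using this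
  refine hasDerivAt_of_tendstoUniformly (l := Filter.atTop) (f := fun n t => ∫ p, F n t p ∂mu)
    (f' := fun n t => ∫ p, F' n t p ∂mu)
    (g' := fun t => ∫ p, ((vv t p ^ 2 - uu t p ^ 2) * log (uu t p) + vv t p ^ 2) ∂mu) ?_ ?_ ?_ θ
  · rw [Metric.tendstoUniformly_iff]
    intro ε hε
    filter_upwards [hz.eventually (gt_mem_nhds hε)] with n hn t
    rw [dist_comm, Real.dist_eq]
    exact (hb1 n t).trans_lt hn
  · refine Filter.Eventually.of_forall fun n t => hasDeriv_int (F n) (F' n) (hFc n) (hFc' n) ?_ t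
    intro t p
    have hl := (((uu_deriv t p).pow 2).add_const (δ n ^ 4)).log (hpos n t p).ne'
    have := ((uu_deriv t p).mul (vv_deriv t p)).mul (hl.const_mul (1 / 2))
    simp only [hF, hF']
    refine HasDerivAt.congr_deriv (f := fun t => uu t p * vv t p * (1 / 2 * log (uu t p ^ 2 + δ n ^ 4))) this ?_
    simp only [Pi.mul_apply, Pi.pow_apply]
    have := (hpos n t p).ne'
    field_simp
    push_cast
    ring
  · intro t
    rw [tendsto_iff_dist_tendsto_zero]
    refine squeeze_zero (fun _ => dist_nonneg) (fun n => ?_) hz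
    rw [Real.dist_eq]
    exact hb0 n t

/-- With `u_θ = φ₁ cos θ - φ₂ sin θ`, `u'_θ = ∂u_θ/∂θ = -φ₁ sin θ - φ₂ cos θ` on
`Ω = (0,1)²` and `g(θ) = -∫_Ω u_θ² log|u_θ|`, if `g` is twice differentiable then
`g''(θ) = -2(1/4 + g(θ) + ∫_Ω (u'_θ)² log|u_θ|)`; in particular `g''(θ) > 0` iff
`-∫_Ω (u'_θ)² log|u_θ| > 1/4 + g(θ)`. -/
theorem stmt19 (g : ℝ → ℝ)
    (hg : ∀ θ, g θ = -∫ p in (Ioo (0:ℝ) 1) ×ˢ (Ioo (0:ℝ) 1),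
      ((Real.sin (π * p.1) * Real.sin (2 * π * p.2)) * Real.cos θ -
        (Real.sin (2 * π * p.1) * Real.sin (π * p.2)) * Real.sin θ) ^ 2 *
      Real.log (|(Real.sin (π * p.1) * Real.sin (2 * π * p.2)) * Real.cos θ -
        (Real.sin (2 * π * p.1) * Real.sin (π * p.2)) * Real.sin θ|))
    (hdiff : ∀ θ, DifferentiableAt ℝ g θ ∧ DifferentiableAt ℝ (deriv g) θ)
    (θ : ℝ) :
    deriv (deriv g) θ = -2 * (1 / 4 + g θ +
      ∫ p in (Ioo (0:ℝ) 1) ×ˢ (Ioo (0:ℝ) 1),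
        (-(Real.sin (π * p.1) * Real.sin (2 * π * p.2)) * Real.sin θ -
          (Real.sin (2 * π * p.1) * Real.sin (π * p.2)) * Real.cos θ) ^ 2 *
        Real.log (|(Real.sin (π * p.1) * Real.sin (2 * π * p.2)) * Real.cos θ -
          (Real.sin (2 * π * p.1) * Real.sin (π * p.2)) * Real.sin θ|)) ∧
    (0 < deriv (deriv g) θ ↔
      1 / 4 + g θ <
        -∫ p in (Ioo (0:ℝ) 1) ×ˢ (Ioo (0:ℝ) 1),
          (-(Real.sin (π * p.1) * Real.sin (2 * π * p.2)) * Real.sin θ -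
            (Real.sin (2 * π * p.1) * Real.sin (π * p.2)) * Real.cos θ) ^ 2 *
          Real.log (|(Real.sin (π * p.1) * Real.sin (2 * π * p.2)) * Real.cos θ -
            (Real.sin (2 * π * p.1) * Real.sin (π * p.2)) * Real.sin θ|)) := by
  have hg' : ∀ t, g t = -∫ p, uu t p ^ 2 * log (uu t p) ∂mu := by
    intro t
    rw [hg]
    simp only [Real.log_abs]
    rfl
  have hI : (∫ p in (Ioo (0:ℝ) 1) ×ˢ (Ioo (0:ℝ) 1),
        (-(Real.sin (π * p.1) * Real.sin (2 * π * p.2)) * Real.sin θ -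
          (Real.sin (2 * π * p.1) * Real.sin (π * p.2)) * Real.cos θ) ^ 2 *
        Real.log (|(Real.sin (π * p.1) * Real.sin (2 * π * p.2)) * Real.cos θ -
          (Real.sin (2 * π * p.1) * Real.sin (π * p.2)) * Real.sin θ|)) =
      ∫ p, vv θ p ^ 2 * log (uu θ p) ∂mu := by
    simp only [Real.log_abs]
    rfl
  rw [hI]
  have hd1 : deriv g = fun t => -(2 * ∫ p, uu t p * vv t p * log (uu t p) ∂mu) := by
    ext t
    have : g = fun t => -∫ p, uu t p ^ 2 * log (uu t p) ∂mu := funext hg'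
    rw [this]
    exact (G_deriv t).neg.deriv
  have hd2 : deriv (deriv g) θ = -2 * (1 / 4 + g θ + ∫ p, vv θ p ^ 2 * log (uu θ p) ∂mu) := by
    rw [hd1, ((second_deriv θ).const_mul 2).fun_neg.deriv, hg']
    have : ∫ p, ((vv θ p ^ 2 - uu θ p ^ 2) * log (uu θ p) + vv θ p ^ 2) ∂mu =
        ∫ p, vv θ p ^ 2 * log (uu θ p) ∂mu - ∫ p, uu θ p ^ 2 * log (uu θ p) ∂mu + 1 / 4 := by
      have hv : Integrable (fun p => vv θ p ^ 2) mu := int_of_cont (by fun_prop)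
      have e1 := integral_add ((int_vlog θ).sub (int_ulog θ)) hv
      have e2 := integral_sub (int_vlog θ) (int_ulog θ)
      simp only [Pi.sub_apply] at e1
      rw [← int_vv θ, ← e2, ← e1]
      congr 1; ext p; ring
    rw [this]
    ring
  refine ⟨hd2, ?_⟩
  rw [hd2]
  constructor <;> intro h <;> linarith
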